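/- Let S = (A_n)_{n∈ℕ} be a sequence of d×d integer matrices such that for some τ ≥ 1/d one has (1/N) Σ_{n=1}^N ‖A_n‖ ≪ N^τ for all N ∈ ℕ, and such that A_n − A_m is invertible whenever n ≠ m. Let E_S be the set of points x ∈ T_d = [0,1]^d such that the sequence x A_n, n = 1, 2, …, is not uniformly distributed modulo 1; equivalently (by the Weyl criterion), E_S is the set of x ∈ T_d for which there exists a nonzero h ∈ ℤ^d such that (1/N) Σ_{n=1}^N e(⟨x A_n, h⟩) does not tend to 0 as N → ∞. Then dim E_S ≤ d − 1/τ. -/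

import Mathlib

open MeasureTheory

noncomputable def eC (z : ℝ) : ℂ := Complex.exp (2 * Real.pi * Complex.I * z)

/-- The Euclidean operator norm of a real `d × d` matrix. -/
noncomputable def matOpNorm (d : ℕ) (M : Matrix (Fin d) (Fin d) ℝ) : ℝ :=
  ‖LinearMap.toContinuousLinearMap (Matrix.toEuclideanLin M)‖

lemma eC_add (a b : ℝ) : eC (a + b) = eC a * eC b := by
  simp only [eC, ← Complex.exp_add]
  push_cast
  ring_nf

lemma eC_sum {ι : Type*} (s : Finset ι) (f : ι → ℝ) : eC (∑ i ∈ s, f i) = ∏ i ∈ s, eC (f i) := by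
  simp only [eC, ← Complex.exp_sum, Complex.ofReal_sum, Finset.mul_sum]

lemma norm_eC (a : ℝ) : ‖eC a‖ = 1 := by
  have : eC a = Complex.exp ((2 * Real.pi * a : ℝ) * Complex.I) := by
    simp only [eC]; push_cast; ring_nf
  rw [this, Complex.norm_exp_ofReal_mul_I]

lemma conj_eC (a : ℝ) : (starRingEnd ℂ) (eC a) = eC (-a) := by
  have h2 : (starRingEnd ℂ) 2 = 2 := Complex.conj_ofNat 2
  simp only [eC, ← Complex.exp_conj]
  simp [h2]

lemma continuous_eC : Continuous eC := by
  unfold eC; fun_prop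

lemma norm_eC_sub_le (a b : ℝ) : ‖eC a - eC b‖ ≤ 2 * Real.pi * |a - b| := by
  have h : eC a - eC b = eC b * (Complex.exp (Complex.I * (2 * Real.pi * (a - b) : ℝ)) - 1) := by
    have h1 : Complex.exp (Complex.I * (2 * Real.pi * (a - b) : ℝ)) = eC (a - b) := by
      simp only [eC]; push_cast; ring_nf
    rw [h1, mul_sub, ← eC_add]
    ring_nf
  rw [h, norm_mul, norm_eC, one_mul]
  refine Real.norm_exp_I_mul_ofReal_sub_one_le.trans_eq ?_
  rw [Real.norm_eq_abs, abs_mul, abs_of_nonneg (by positivity)]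

/-- The restriction of Lebesgue measure to the cube `[0, 2)^d`. -/
noncomputable def cubeMeasure (d : ℕ) : Measure (Fin d → ℝ) :=
  Measure.pi fun _ => volume.restrict (Set.Ico 0 2)

instance (d : ℕ) : IsFiniteMeasure (cubeMeasure d) := by
  unfold cubeMeasure; infer_instance

lemma cubeMeasure_eq_restrict (d : ℕ) :
    cubeMeasure d = volume.restrict (Set.univ.pi fun _ => Set.Ico (0 : ℝ) 2) :=
  (Measure.restrict_pi_pi (fun _ => volume) _).symm

lemma integral_eC_int_mul (w : ℤ) (hw : w ≠ 0) :
    ∫ x in Set.Ico (0 : ℝ) 2, eC (x * w) = 0 := by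
  have hc : (2 * Real.pi * Complex.I * w : ℂ) ≠ 0 := by
    simp [Real.pi_ne_zero, hw]
  have h : ∀ x : ℝ, eC (x * w) = Complex.exp ((2 * Real.pi * Complex.I * w) * x) := by
    intro x; simp only [eC]; push_cast; ring_nf
  simp_rw [h]
  rw [integral_Ico_eq_integral_Ioc, ← intervalIntegral.integral_of_le (by norm_num),
    integral_exp_mul_complex hc]
  have h2 : (2 * Real.pi * Complex.I * w * ((2 : ℝ) : ℂ) : ℂ)
      = ((2 * w : ℤ) : ℂ) * (2 * Real.pi * Complex.I) := by push_cast; ring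
  rw [h2, Complex.exp_int_mul_two_pi_mul_I]
  simp

lemma integral_eC_cubeMeasure {d : ℕ} (w : Fin d → ℤ) :
    ∫ x, eC (∑ i, x i * (w i : ℝ)) ∂cubeMeasure d = if w = 0 then (2 : ℂ) ^ d else 0 := by
  simp_rw [eC_sum]
  unfold cubeMeasure
  rw [integral_fintype_prod_eq_prod (fun i (x : ℝ) => eC (x * (w i : ℝ)))]
  split_ifs with hw
  · subst hw
    simp [eC]
  · obtain ⟨i, hi⟩ := Function.ne_iff.mp hw
    exact Finset.prod_eq_zero (Finset.mem_univ i) (integral_eC_int_mul _ hi)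

/-- The exponential sum of length `N` with frequencies `v 1, …, v N`. -/
noncomputable def expSum {d : ℕ} (v : ℕ → Fin d → ℤ) (N : ℕ) (x : Fin d → ℝ) : ℂ :=
  ∑ n ∈ Finset.Icc 1 N, eC (∑ i, x i * (v n i : ℝ))

lemma continuous_expSum {d : ℕ} (v : ℕ → Fin d → ℤ) (N : ℕ) : Continuous (expSum v N) := by
  unfold expSum
  refine continuous_finsetSum _ fun n _ => continuous_eC.comp ?_
  fun_prop

lemma norm_expSum_le {d : ℕ} (v : ℕ → Fin d → ℤ) (N : ℕ) (x : Fin d → ℝ) :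
    ‖expSum v N x‖ ≤ N := by
  refine (norm_sum_le _ _).trans ?_
  simp [norm_eC]

lemma integrable_of_continuous_of_bound {d : ℕ} {E : Type*} [NormedAddCommGroup E]
    [SecondCountableTopology E] {f : (Fin d → ℝ) → E}
    (hf : Continuous f) (C : ℝ) (hC : ∀ x, ‖f x‖ ≤ C) : Integrable f (cubeMeasure d) := by
  borelize E
  exact Integrable.of_bound hf.aestronglyMeasurable C (Filter.Eventually.of_forall hC)

lemma integral_norm_expSum_sq {d : ℕ} (v : ℕ → Fin d → ℤ) (hv : Function.Injective v) (N : ℕ) :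
    ∫ x, ‖expSum v N x‖ ^ 2 ∂cubeMeasure d = 2 ^ d * N := by
  have key : ∀ x : Fin d → ℝ, ((‖expSum v N x‖ ^ 2 : ℝ) : ℂ) =
      ∑ n ∈ Finset.Icc 1 N, ∑ m ∈ Finset.Icc 1 N, eC (∑ i, x i * ((v n - v m) i : ℤ)) := by
    intro x
    push_cast
    rw [← Complex.mul_conj']
    simp only [expSum, map_sum, conj_eC, Finset.sum_mul_sum, ← eC_add, ← Finset.sum_neg_distrib,
      ← Finset.sum_add_distrib]
    refine Finset.sum_congr rfl fun n _ => Finset.sum_congr rfl fun m _ => ?_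
    congr 1
    refine Finset.sum_congr rfl fun i _ => ?_
    simp only [Pi.sub_apply]
    push_cast
    ring
  have hint : ∀ w : Fin d → ℤ, Integrable (fun x : Fin d → ℝ => eC (∑ i, x i * (w i : ℝ)))
      (cubeMeasure d) := fun w =>
    integrable_of_continuous_of_bound (continuous_eC.comp (by fun_prop)) 1 fun x => (norm_eC _).le
  have : ((∫ x, ‖expSum v N x‖ ^ 2 ∂cubeMeasure d : ℝ) : ℂ) = 2 ^ d * N := by
    rw [← integral_complex_ofReal]
    simp_rw [key]
    rw [integral_finsetSum _ fun n _ => integrable_finsetSum _ fun m _ => hint _]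
    simp_rw [integral_finsetSum _ fun m _ => hint _, integral_eC_cubeMeasure, sub_eq_zero,
      hv.eq_iff, Finset.sum_ite_eq]
    rw [Finset.sum_congr rfl fun n hn => if_pos hn]
    simp [mul_comm]
  exact_mod_cast this

lemma norm_expSum_sub_le {d : ℕ} (v : ℕ → Fin d → ℤ) (N : ℕ) (x y : Fin d → ℝ) (r : ℝ)
    (hxy : ∀ i, |x i - y i| ≤ r) :
    ‖expSum v N x - expSum v N y‖
      ≤ 2 * Real.pi * r * ∑ n ∈ Finset.Icc 1 N, ∑ i, |(v n i : ℝ)| := by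
  rw [expSum, expSum, ← Finset.sum_sub_distrib, Finset.mul_sum]
  refine norm_sum_le_of_le _ fun n _ => (norm_eC_sub_le _ _).trans ?_
  rw [mul_assoc (2 * Real.pi)]
  refine mul_le_mul_of_nonneg_left ?_ (by positivity)
  rw [← Finset.sum_sub_distrib, Finset.mul_sum]
  refine Finset.abs_sum_le_sum_abs _ _ |>.trans (Finset.sum_le_sum fun i _ => ?_)
  rw [← sub_mul, abs_mul]
  exact mul_le_mul_of_nonneg_right (hxy i) (abs_nonneg _)

/-- The half-open cube of side `1 / M` with lower corner `j / M`. -/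
def gridCube {d : ℕ} (M : ℕ) (j : Fin d → ℤ) : Set (Fin d → ℝ) :=
  Set.univ.pi fun i => Set.Ico ((j i : ℝ) / M) (((j i : ℝ) + 1) / M)

lemma measurableSet_gridCube {d : ℕ} (M : ℕ) (j : Fin d → ℤ) : MeasurableSet (gridCube M j) :=
  MeasurableSet.univ_pi fun _ => measurableSet_Ico

lemma mem_gridCube_iff {d : ℕ} {M : ℕ} (hM : 0 < M) (j : Fin d → ℤ) (x : Fin d → ℝ) :
    x ∈ gridCube M j ↔ ∀ i, ⌊x i * M⌋ = j i := by
  have hM' : (0 : ℝ) < M := by exact_mod_cast hM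
  simp [gridCube, Int.floor_eq_iff, div_le_iff₀ hM', lt_div_iff₀ hM']

lemma gridCube_disjoint {d : ℕ} {M : ℕ} (hM : 0 < M) :
    Pairwise fun j k : Fin d → ℤ => Disjoint (gridCube M j) (gridCube M k) := by
  intro j k hjk
  refine Set.disjoint_left.2 fun x hx hy => hjk ?_
  rw [mem_gridCube_iff hM] at hx hy
  exact funext fun i => (hx i).symm.trans (hy i)

lemma abs_sub_le_of_mem_gridCube {d : ℕ} {M : ℕ} {j : Fin d → ℤ} {x y : Fin d → ℝ}
    (hx : x ∈ gridCube M j) (hy : y ∈ gridCube M j) (i : Fin d) : |x i - y i| ≤ 1 / M := by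
  have h1 := hx i trivial
  have h2 := hy i trivial
  simp only [Set.mem_Ico, add_div] at h1 h2
  rw [abs_le]
  constructor <;> linarith

lemma ediam_gridCube_le {d : ℕ} (M : ℕ) (j : Fin d → ℤ) :
    Metric.ediam (gridCube M j) ≤ ENNReal.ofReal (1 / M) := by
  refine Metric.ediam_pi_le_of_le fun i => ?_
  rw [Real.ediam_Ico]
  exact ENNReal.ofReal_le_ofReal (by rw [add_div]; linarith)

lemma cubeMeasure_gridCube {d : ℕ} {M : ℕ} (hM : 0 < M) (j : Fin d → ℤ)
    (hj : ∀ i, j i ∈ Finset.Icc (0 : ℤ) M) :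
    (cubeMeasure d).real (gridCube M j) = (1 / M : ℝ) ^ d := by
  have hM' : (1 : ℝ) ≤ M := by exact_mod_cast hM
  have hsub : gridCube M j ⊆ Set.univ.pi fun _ => Set.Ico (0 : ℝ) 2 := by
    refine Set.pi_mono fun i _ => Set.Ico_subset_Ico ?_ ?_
    · have := (Finset.mem_Icc.1 (hj i)).1
      positivity
    · have : (j i : ℝ) ≤ M := by exact_mod_cast (Finset.mem_Icc.1 (hj i)).2
      rw [div_le_iff₀ (by positivity)]
      linarith
  rw [cubeMeasure_eq_restrict, measureReal_def, Measure.restrict_apply (measurableSet_gridCube _ _),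
    Set.inter_eq_self_of_subset_left hsub, gridCube, Real.volume_pi_Ico_toReal]
  · simp [add_div]
  · intro i
    simp only [add_div]
    have : 0 ≤ 1 / (M : ℝ) := by positivity
    linarith

open Classical in
/-- The indices of the grid cubes meeting `[0, 1]^d` in which `‖expSum v N x‖ ≥ T` occurs. -/
noncomputable def badCubes {d : ℕ} (v : ℕ → Fin d → ℤ) (N M : ℕ) (T : ℝ) :
    Finset (Fin d → ℤ) :=
  (Fintype.piFinset fun _ => Finset.Icc (0 : ℤ) M).filter
    fun j => ∃ x ∈ gridCube M j, T ≤ ‖expSum v N x‖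

lemma exists_badCube {d : ℕ} (v : ℕ → Fin d → ℤ) (N : ℕ) {M : ℕ} (hM : 0 < M) {T : ℝ}
    {x : Fin d → ℝ} (hx : ∀ i, x i ∈ Set.Icc (0 : ℝ) 1) (hT : T ≤ ‖expSum v N x‖) :
    ∃ j ∈ badCubes v N M T, x ∈ gridCube M j := by
  classical
  have hmem : x ∈ gridCube M (fun i => ⌊x i * M⌋) := (mem_gridCube_iff hM _ _).2 fun _ => rfl
  refine ⟨fun i => ⌊x i * M⌋, ?_, hmem⟩
  simp only [badCubes, Finset.mem_filter, Fintype.mem_piFinset, Finset.mem_Icc]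
  refine ⟨fun i => ⟨?_, ?_⟩, x, hmem, hT⟩
  · have := (hx i).1
    exact Int.floor_nonneg.2 (by positivity)
  · have : x i * M ≤ ((M : ℤ) : ℝ) := by
      simpa using mul_le_mul_of_nonneg_right (hx i).2 (Nat.cast_nonneg (α := ℝ) M)
    exact_mod_cast (Int.floor_le _).trans this

lemma mem_Icc_of_mem_badCubes {d : ℕ} {v : ℕ → Fin d → ℤ} {N M : ℕ} {T : ℝ} {j : Fin d → ℤ}
    (hj : j ∈ badCubes v N M T) (i : Fin d) : j i ∈ Finset.Icc (0 : ℤ) M := by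
  classical
  exact Fintype.mem_piFinset.1 (Finset.mem_filter.1 hj).1 i

lemma card_badCubes_mul_le {d : ℕ} (v : ℕ → Fin d → ℤ) (hv : Function.Injective v) (N : ℕ)
    {M : ℕ} (hM : 0 < M) {T : ℝ} (hT : 0 < T)
    (hlip : 2 * Real.pi * (1 / M) * ∑ n ∈ Finset.Icc 1 N, ∑ i, |(v n i : ℝ)| ≤ T / 2) :
    (badCubes v N M T).card * (1 / M : ℝ) ^ d * (T / 2) ^ 2 ≤ 2 ^ d * N := by
  classical
  have hcont : Continuous fun x => ‖expSum v N x‖ ^ 2 := (continuous_expSum v N).norm.pow 2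
  have hint : Integrable (fun x => ‖expSum v N x‖ ^ 2) (cubeMeasure d) :=
    integrable_of_continuous_of_bound hcont ((N : ℝ) ^ 2) fun x => by
      rw [norm_pow, norm_norm]
      exact pow_le_pow_left₀ (norm_nonneg _) (norm_expSum_le _ _ _) 2
  have hmarkov := mul_meas_ge_le_integral_of_nonneg
    (Filter.Eventually.of_forall fun x => sq_nonneg ‖expSum v N x‖) hint ((T / 2) ^ 2)
  rw [integral_norm_expSum_sq v hv] at hmarkov
  have hsub : (⋃ j ∈ badCubes v N M T, gridCube M j)
      ⊆ {x | (T / 2) ^ 2 ≤ ‖expSum v N x‖ ^ 2} := by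
    simp only [Set.iUnion_subset_iff]
    intro j hj y hy
    obtain ⟨-, x, hx, hxT⟩ := Finset.mem_filter.1 hj
    have h1 := (norm_expSum_sub_le v N x y (1 / M) (abs_sub_le_of_mem_gridCube hx hy)).trans hlip
    have h2 := norm_sub_norm_le (expSum v N x) (expSum v N y)
    have h3 : T / 2 ≤ ‖expSum v N y‖ := by linarith
    exact pow_le_pow_left₀ (by positivity) h3 2
  have hmeas : (cubeMeasure d).real (⋃ j ∈ badCubes v N M T, gridCube M j)
      = (badCubes v N M T).card * (1 / M : ℝ) ^ d := by
    rw [measureReal_biUnion_finset (fun j _ k _ hjk => gridCube_disjoint hM hjk)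
      fun j _ => measurableSet_gridCube M j, Finset.sum_congr rfl fun j hj =>
        cubeMeasure_gridCube hM j (mem_Icc_of_mem_badCubes hj)]
    simp
  rw [← hmeas, mul_comm]
  exact (mul_le_mul_of_nonneg_left (measureReal_mono hsub) (by positivity)).trans hmarkov

/-- A Borel–Cantelli (convergence) criterion for Hausdorff measures. -/
lemma hausdorffMeasure_eq_zero_of_frequently_mem {X ι : Type*} [EMetricSpace X]
    [MeasurableSpace X] [BorelSpace X] [Countable ι] {s : ℝ} (hs : 0 < s) {E : Set X}
    (J : ℕ → Finset ι) (t : ℕ → ι → Set X) (δ : ℕ → ENNReal) (hanti : Antitone δ)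
    (hlim : Filter.Tendsto δ Filter.atTop (nhds 0))
    (hdiam : ∀ k, ∀ j ∈ J k, Metric.ediam (t k j) ≤ δ k)
    (hsum : ∑' k, ((J k).card : ENNReal) * δ k ^ s ≠ ⊤)
    (hE : ∀ x ∈ E, ∃ᶠ k in Filter.atTop, ∃ j ∈ J k, x ∈ t k j) :
    μH[s] E = 0 := by
  classical
  let u : ℕ → ℕ × ι → Set X := fun n p => if p.2 ∈ J (p.1 + n) then t (p.1 + n) p.2 else ∅
  have hu : ∀ n p, Metric.ediam (u n p) ≤ δ n := by
    intro n p
    simp only [u]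
    split_ifs with h
    · exact (hdiam _ _ h).trans (hanti (Nat.le_add_left _ _))
    · simp
  have hcover : ∀ n, E ⊆ ⋃ p, u n p := by
    intro n x hx
    obtain ⟨k, hk, j, hj, hxj⟩ := Filter.frequently_atTop.1 (hE x hx) n
    refine Set.mem_iUnion.2 ⟨(k - n, j), ?_⟩
    simp only [u, Nat.sub_add_cancel hk, if_pos hj]
    exact hxj
  have hle : ∀ n, ∑' p, Metric.ediam (u n p) ^ s
      ≤ ∑' k, ((J (k + n)).card : ENNReal) * δ (k + n) ^ s := by
    intro n
    rw [ENNReal.tsum_prod (f := fun k j => Metric.ediam (u n (k, j)) ^ s)]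
    refine ENNReal.tsum_le_tsum fun k => ?_
    rw [tsum_eq_sum (s := J (k + n)) fun j hj => by
      simp [u, if_neg hj, ENNReal.zero_rpow_of_pos hs], ← nsmul_eq_mul]
    refine Finset.sum_le_card_nsmul _ _ _ fun j hj => ?_
    simp only [u, if_pos hj]
    exact ENNReal.rpow_le_rpow (hdiam _ _ hj) hs.le
  have htail := ENNReal.tendsto_sum_nat_add _ hsum
  have hzero : Filter.Tendsto (fun n => ∑' p, Metric.ediam (u n p) ^ s) Filter.atTop (nhds 0) :=
    tendsto_of_tendsto_of_tendsto_of_le_of_le tendsto_const_nhds htail (fun _ => zero_le) hle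
  have := Measure.hausdorffMeasure_le_liminf_tsum s E δ hlim u
    (Filter.Eventually.of_forall fun n p => hu n p) (Filter.Eventually.of_forall hcover)
  rw [hzero.liminf_eq] at this
  exact le_antisymm this zero_le

lemma card_badCubes_le {d : ℕ} (v : ℕ → Fin d → ℤ) (hv : Function.Injective v) {τ L c ε : ℝ}
    (hτ : 0 < τ) (hL : 0 < L) (hc : 1 < c) (hε : 0 < ε)
    (hgrow : ∀ N : ℕ, 1 ≤ N →
      ∑ n ∈ Finset.Icc 1 N, ∑ i, |(v n i : ℝ)| ≤ L * (N : ℝ) ^ τ * N) :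
    ∃ (M : ℕ → ℕ) (C D : ℝ), 0 < C ∧ 0 < D ∧ ∀ k, 0 < M k ∧
      1 / (M k : ℝ) ≤ D * (c ^ (-τ)) ^ k ∧
      ((badCubes v ⌊c ^ k⌋₊ (M k) (ε * ⌊c ^ k⌋₊)).card : ℝ) ≤ C * (c ^ (τ * d - 1)) ^ k := by
  have hc0 : 0 < c := by linarith
  set B : ℝ := 4 * Real.pi * L / ε with hB
  have hBpos : 0 < B := by positivity
  refine ⟨fun k => ⌈B * (⌊c ^ k⌋₊ : ℝ) ^ τ⌉₊, 2 ^ d * 8 / ε ^ 2 * (B + 1) ^ d, 2 ^ τ / B,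
    by positivity, by positivity, fun k => ?_⟩
  have hck : 1 ≤ c ^ k := one_le_pow₀ hc.le
  set Q : ℝ := c ^ k with hQ
  have hQ0 : 0 < Q := by linarith
  set N : ℕ := ⌊Q⌋₊ with hN
  have hN1 : 1 ≤ N := Nat.floor_pos.2 hck
  have hN1' : (1 : ℝ) ≤ N := by exact_mod_cast hN1
  have hN0 : (0 : ℝ) < N := by linarith
  have hNQ : (N : ℝ) ≤ Q := Nat.floor_le hQ0.le
  have hQN : Q / 2 ≤ N := (Nat.div_two_lt_floor hck).le
  have hNτ1 : 1 ≤ (N : ℝ) ^ τ := Real.one_le_rpow hN1' hτ.le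
  set M : ℕ := ⌈B * (N : ℝ) ^ τ⌉₊ with hM
  have hBM : B * (N : ℝ) ^ τ ≤ M := Nat.le_ceil _
  have hM0' : (0 : ℝ) < M := lt_of_lt_of_le (by positivity) hBM
  have hM0 : 0 < M := by exact_mod_cast hM0'
  have hMle : (M : ℝ) ≤ (B + 1) * Q ^ τ := by
    have h1 : (M : ℝ) ≤ B * (N : ℝ) ^ τ + 1 := (Nat.ceil_lt_add_one (by positivity)).le
    have h2 : (N : ℝ) ^ τ ≤ Q ^ τ := Real.rpow_le_rpow hN0.le hNQ hτ.le
    nlinarith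
  refine ⟨hM0, ?_, ?_⟩
  · have h1 : (c ^ (-τ)) ^ k = (Q ^ τ)⁻¹ := by
      rw [hQ, ← Real.rpow_natCast, ← Real.rpow_natCast, ← Real.rpow_mul hc0.le,
        ← Real.rpow_mul hc0.le, ← Real.rpow_neg hc0.le]
      ring_nf
    have h2 : Q ^ τ / 2 ^ τ ≤ (N : ℝ) ^ τ := by
      rw [← Real.div_rpow hQ0.le (by norm_num)]
      exact Real.rpow_le_rpow (by positivity) hQN hτ.le
    have h3 : 1 / (M : ℝ) ≤ 1 / (B * (Q ^ τ / 2 ^ τ)) :=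
      one_div_le_one_div_of_le (by positivity)
        ((mul_le_mul_of_nonneg_left h2 hBpos.le).trans hBM)
    refine h3.trans_eq ?_
    rw [h1]
    field_simp
  · have hlip : 2 * Real.pi * (1 / M) * ∑ n ∈ Finset.Icc 1 N, ∑ i, |(v n i : ℝ)|
        ≤ ε * N / 2 := by
      refine (mul_le_mul_of_nonneg_left (hgrow N hN1) (by positivity)).trans ?_
      have h1 : 2 * Real.pi * (1 / M) * (L * (N : ℝ) ^ τ * N)
          = (B * (N : ℝ) ^ τ) / M * (ε * N / 2) := by
        rw [hB]; field_simp; ring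
      rw [h1]
      exact mul_le_of_le_one_left (by positivity) ((div_le_one hM0').2 hBM)
    have hcard := card_badCubes_mul_le v hv N hM0 (T := ε * N) (by positivity) hlip
    set K : ℝ := ((badCubes v N M (ε * N)).card : ℝ)
    have h1 : K ≤ 2 ^ d * 4 / ε ^ 2 * (M : ℝ) ^ d * (1 / N) := by
      have h2 : K * (1 / M : ℝ) ^ d * (ε * N / 2) ^ 2
          = K * (ε ^ 2 * N ^ 2 / (4 * M ^ d)) := by
        rw [one_div, inv_pow]; field_simp; ring
      rw [h2, ← le_div_iff₀ (by positivity)] at hcard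
      refine hcard.trans_eq ?_
      field_simp
    have h2 : (c ^ (τ * d - 1)) ^ k = (Q ^ τ) ^ d * (1 / Q) := by
      rw [hQ, Real.rpow_sub hc0, Real.rpow_one, div_pow, Real.rpow_mul hc0.le, Real.rpow_natCast,
        ← pow_mul, mul_comm d k, pow_mul, ← Real.rpow_natCast (c ^ τ) k, ← Real.rpow_natCast c k,
        ← Real.rpow_mul hc0.le, ← Real.rpow_mul hc0.le, mul_comm τ]
      ring
    have h3 : 1 / (N : ℝ) ≤ 2 * (1 / Q) := by
      rw [div_le_iff₀ hN0]
      calc (1 : ℝ) = 2 * (1 / Q) * (Q / 2) := by field_simp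
        _ ≤ 2 * (1 / Q) * N := mul_le_mul_of_nonneg_left hQN (by positivity)
    calc K ≤ 2 ^ d * 4 / ε ^ 2 * (M : ℝ) ^ d * (1 / N) := h1
      _ ≤ 2 ^ d * 4 / ε ^ 2 * ((B + 1) * Q ^ τ) ^ d * (2 * (1 / Q)) := by gcongr
      _ = 2 ^ d * 8 / ε ^ 2 * (B + 1) ^ d * (c ^ (τ * d - 1)) ^ k := by
        rw [h2, mul_pow]; ring

lemma dimH_frequently_le_norm_expSum {d : ℕ} (v : ℕ → Fin d → ℤ) (hv : Function.Injective v)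
    {τ L c ε : ℝ} (hτ : 0 < τ) (hL : 0 < L) (hc : 1 < c) (hε : 0 < ε)
    (hgrow : ∀ N : ℕ, 1 ≤ N →
      ∑ n ∈ Finset.Icc 1 N, ∑ i, |(v n i : ℝ)| ≤ L * (N : ℝ) ^ τ * N)
    {s : NNReal} (hs : 0 < s) (hsd : (d : ℝ) - 1 / τ < s) :
    dimH {x : Fin d → ℝ | (∀ i, x i ∈ Set.Icc (0 : ℝ) 1) ∧
      ∃ᶠ k : ℕ in Filter.atTop, ε * ⌊c ^ k⌋₊ ≤ ‖expSum v ⌊c ^ k⌋₊ x‖} ≤ s := by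
  obtain ⟨M, C, D, hC, hD, hM⟩ := card_badCubes_le v hv hτ hL hc hε hgrow
  have hc0 : 0 < c := by linarith
  have hρ0 : 0 < c ^ (-τ) := by positivity
  have hρ1 : c ^ (-τ) < 1 := Real.rpow_lt_one_of_one_lt_of_neg hc (by linarith)
  have hθ : c ^ (τ * d - 1) * (c ^ (-τ)) ^ (s : ℝ) < 1 := by
    rw [← Real.rpow_mul hc0.le, ← Real.rpow_add hc0]
    refine Real.rpow_lt_one_of_one_lt_of_neg hc ?_
    have := mul_lt_mul_of_pos_left hsd hτ
    rw [mul_sub, mul_one_div_cancel hτ.ne'] at this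
    linarith
  have hzero := hausdorffMeasure_eq_zero_of_frequently_mem (s := s) (by exact_mod_cast hs)
    (E := {x : Fin d → ℝ | (∀ i, x i ∈ Set.Icc (0 : ℝ) 1) ∧
      ∃ᶠ k : ℕ in Filter.atTop, ε * ⌊c ^ k⌋₊ ≤ ‖expSum v ⌊c ^ k⌋₊ x‖})
    (fun k => badCubes v ⌊c ^ k⌋₊ (M k) (ε * ⌊c ^ k⌋₊)) (fun k => gridCube (M k))
    (fun k => ENNReal.ofReal (D * (c ^ (-τ)) ^ k)) ?_ ?_ ?_ ?_ ?_
  · exact dimH_le_of_hausdorffMeasure_ne_top (by rw [hzero]; exact ENNReal.zero_ne_top)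
  · intro a b hab
    exact ENNReal.ofReal_le_ofReal
      (mul_le_mul_of_nonneg_left (pow_le_pow_of_le_one hρ0.le hρ1.le hab) hD.le)
  · have := ((tendsto_pow_atTop_nhds_zero_of_lt_one hρ0.le hρ1).const_mul D)
    simpa using ENNReal.tendsto_ofReal this
  · intro k j _
    exact (ediam_gridCube_le _ _).trans (ENNReal.ofReal_le_ofReal (hM k).2.1)
  · have hsum : Summable fun k : ℕ =>
        C * D ^ (s : ℝ) * (c ^ (τ * d - 1) * (c ^ (-τ)) ^ (s : ℝ)) ^ k :=
      (summable_geometric_of_lt_one (by positivity) hθ).mul_left _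
    refine ne_top_of_le_ne_top hsum.tsum_ofReal_ne_top (ENNReal.tsum_le_tsum fun k => ?_)
    rw [ENNReal.ofReal_rpow_of_nonneg (by positivity) (by positivity), ← ENNReal.ofReal_natCast,
      ← ENNReal.ofReal_mul (by positivity)]
    refine ENNReal.ofReal_le_ofReal ?_
    refine (mul_le_mul_of_nonneg_right (hM k).2.2 (by positivity)).trans_eq ?_
    rw [Real.mul_rpow hD.le (by positivity), mul_pow, ← Real.rpow_pow_comm hρ0.le]
    ring
  · rintro x ⟨hx, hfreq⟩
    exact hfreq.mono fun k hk => exists_badCube v _ (hM k).1 hx hk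

/-- Averages of a bounded real sequence converge to `0` once they do so along the sequences
`⌊c l ^ k⌋` for some `c l ↓ 1`. -/
lemma tendsto_average_real {a : ℕ → ℝ} (ha : ∀ n, |a n| ≤ 1) {c : ℕ → ℝ} (hc : ∀ l, 1 < c l)
    (hc1 : Filter.Tendsto c Filter.atTop (nhds 1))
    (h : ∀ l, Filter.Tendsto
      (fun k : ℕ => (∑ n ∈ Finset.Icc 1 ⌊c l ^ k⌋₊, a n) / (⌊c l ^ k⌋₊ : ℝ))
      Filter.atTop (nhds 0)) :
    Filter.Tendsto (fun N : ℕ => (∑ n ∈ Finset.Icc 1 N, a n) / (N : ℝ))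
      Filter.atTop (nhds 0) := by
  have hu : ∀ N : ℕ, 1 ≤ N → (∑ n ∈ Finset.Icc 1 N, (1 + a n)) / (N : ℝ)
      = 1 + (∑ n ∈ Finset.Icc 1 N, a n) / (N : ℝ) := by
    intro N hN
    have : (N : ℝ) ≠ 0 := by positivity
    rw [Finset.sum_add_distrib]
    simp [add_div, this]
  have hmono : Monotone fun N : ℕ => ∑ n ∈ Finset.Icc 1 N, (1 + a n) := by
    intro N N' hNN
    refine Finset.sum_le_sum_of_subset_of_nonneg (Finset.Icc_subset_Icc_right hNN)
      fun n _ _ => ?_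
    linarith [(abs_le.1 (ha n)).1]
  have key := tendsto_div_of_monotone_of_tendsto_div_floor_pow _ 1 hmono c hc hc1 fun l => by
    have := (h l).const_add 1
    rw [add_zero] at this
    exact this.congr fun k => (hu _ (Nat.floor_pos.2 (one_le_pow₀ (hc l).le))).symm
  have := key.sub_const 1
  rw [sub_self] at this
  refine this.congr' ?_
  filter_upwards [Filter.eventually_ge_atTop 1] with N hN
  rw [hu N hN, add_sub_cancel_left]

lemma tendsto_average_complex {z : ℕ → ℂ} (hz : ∀ n, ‖z n‖ ≤ 1) {c : ℕ → ℝ} (hc : ∀ l, 1 < c l)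
    (hc1 : Filter.Tendsto c Filter.atTop (nhds 1))
    (h : ∀ l, Filter.Tendsto
      (fun k : ℕ => (∑ n ∈ Finset.Icc 1 ⌊c l ^ k⌋₊, z n) / (⌊c l ^ k⌋₊ : ℂ))
      Filter.atTop (nhds 0)) :
    Filter.Tendsto (fun N : ℕ => (∑ n ∈ Finset.Icc 1 N, z n) / (N : ℂ))
      Filter.atTop (nhds 0) := by
  have hre : ∀ N : ℕ, ((∑ n ∈ Finset.Icc 1 N, z n) / (N : ℂ)).re
      = (∑ n ∈ Finset.Icc 1 N, (z n).re) / (N : ℝ) := fun N => by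
    rw [Complex.div_natCast_re, Complex.re_sum]
  have him : ∀ N : ℕ, ((∑ n ∈ Finset.Icc 1 N, z n) / (N : ℂ)).im
      = (∑ n ∈ Finset.Icc 1 N, (z n).im) / (N : ℝ) := fun N => by
    rw [Complex.div_natCast_im, Complex.im_sum]
  have h1 := tendsto_average_real (fun n => (Complex.abs_re_le_norm _).trans (hz n)) hc hc1
    fun l => by
      simpa only [Function.comp_def, hre, Complex.zero_re] using
        (Complex.continuous_re.tendsto 0).comp (h l)
  have h2 := tendsto_average_real (fun n => (Complex.abs_im_le_norm _).trans (hz n)) hc hc1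
    fun l => by
      simpa only [Function.comp_def, him, Complex.zero_im] using
        (Complex.continuous_im.tendsto 0).comp (h l)
  have h3 := ((Complex.continuous_ofReal.tendsto 0).comp h1).add
    (((Complex.continuous_ofReal.tendsto 0).comp h2).mul_const Complex.I)
  simp only [Complex.ofReal_zero, zero_mul, add_zero] at h3
  refine h3.congr fun N => ?_
  simp only [Function.comp_apply]
  rw [← hre, ← him, Complex.re_add_im]

/-- If the averages of the exponential sums do not converge to `0` at `x`, then these sums are
large along some sequence `⌊(1 + 1 / (l + 1)) ^ k⌋`. -/
lemma exists_frequently_le_norm_expSum {d : ℕ} (v : ℕ → Fin d → ℤ) (x : Fin d → ℝ)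
    (hx : ¬ Filter.Tendsto (fun N : ℕ => (1 / (N : ℂ)) * expSum v N x)
      Filter.atTop (nhds 0)) :
    ∃ l m : ℕ, ∃ᶠ k : ℕ in Filter.atTop,
      1 / ((m : ℝ) + 1) * ⌊(1 + 1 / ((l : ℝ) + 1)) ^ k⌋₊
        ≤ ‖expSum v ⌊(1 + 1 / ((l : ℝ) + 1)) ^ k⌋₊ x‖ := by
  contrapose! hx
  have hc1 : Filter.Tendsto (fun l : ℕ => 1 + 1 / ((l : ℝ) + 1)) Filter.atTop (nhds 1) := by
    simpa using (tendsto_one_div_add_atTop_nhds_zero_nat (𝕜 := ℝ)).const_add 1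
  have hc : ∀ l : ℕ, 1 < 1 + 1 / ((l : ℝ) + 1) := fun l => by
    have : 0 < 1 / ((l : ℝ) + 1) := by positivity
    linarith
  have := tendsto_average_complex (z := fun n => eC (∑ i, x i * (v n i : ℝ)))
    (fun n => (norm_eC _).le) hc hc1 fun l => by
      rw [Metric.tendsto_nhds]
      intro ε hε
      obtain ⟨m, hm⟩ := exists_nat_one_div_lt hε
      have hev := hx l m
      filter_upwards [hev] with k hk
      have hN : 0 < ⌊(1 + 1 / ((l : ℝ) + 1)) ^ k⌋₊ :=
        Nat.floor_pos.2 (one_le_pow₀ (hc l).le)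
      rw [dist_zero_right, norm_div, Complex.norm_natCast, div_lt_iff₀ (by exact_mod_cast hN)]
      exact hk.trans_le (mul_le_mul_of_nonneg_right hm.le (Nat.cast_nonneg _))
  refine this.congr fun N => ?_
  rw [one_div, mul_comm, ← div_eq_mul_inv, expSum]

lemma sum_abs_mulVec_le {d : ℕ} (A : Matrix (Fin d) (Fin d) ℤ) (h : Fin d → ℤ) :
    ∑ i, |((A.mulVec h) i : ℝ)|
      ≤ d * ‖WithLp.toLp 2 (fun i => (h i : ℝ))‖ * matOpNorm d (A.map (Int.cast : ℤ → ℝ)) := by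
  set B := A.map (Int.cast : ℤ → ℝ)
  set y : EuclideanSpace ℝ (Fin d) := WithLp.toLp 2 (fun i => (h i : ℝ))
  have hcast : ∀ i, ((A.mulVec h) i : ℝ) = (Matrix.toEuclideanLin B y) i := by
    intro i
    simp [Matrix.mulVec, dotProduct, B, y, Matrix.toLpLin_apply]
  have hle : ∀ i, |((A.mulVec h) i : ℝ)| ≤ matOpNorm d B * ‖y‖ := by
    intro i
    rw [hcast]
    exact (PiLp.norm_apply_le (Matrix.toEuclideanLin B y) i).trans
      ((LinearMap.toContinuousLinearMap (Matrix.toEuclideanLin B)).le_opNorm y)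
  refine (Finset.sum_le_sum fun i _ => hle i).trans_eq ?_
  simp
  ring

lemma injective_mulVec {d : ℕ} {A : ℕ → Matrix (Fin d) (Fin d) ℤ}
    (hinv : ∀ n m : ℕ, n ≠ m → (A n - A m).det ≠ 0) {h : Fin d → ℤ} (hh : h ≠ 0) :
    Function.Injective fun n => (A n).mulVec h := by
  intro n m hnm
  by_contra hne
  refine hh (Matrix.eq_zero_of_mulVec_eq_zero (hinv n m hne) ?_)
  rw [Matrix.sub_mulVec]
  exact sub_eq_zero.2 hnm

lemma sum_vecMul_map_mul {d : ℕ} (A : Matrix (Fin d) (Fin d) ℤ) (h : Fin d → ℤ)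
    (x : Fin d → ℝ) :
    ∑ i, (Matrix.vecMul x (A.map (Int.cast : ℤ → ℝ))) i * (h i : ℝ)
      = ∑ i, x i * ((A.mulVec h) i : ℝ) := by
  have := Matrix.dotProduct_mulVec x (A.map (Int.cast : ℤ → ℝ)) (fun i => (h i : ℝ))
  simp only [dotProduct] at this
  rw [← this]
  simp [Matrix.mulVec, dotProduct]

theorem stmt13 (d : ℕ) (hd : 1 ≤ d) (A : ℕ → Matrix (Fin d) (Fin d) ℤ)
    (τ : ℝ) (hτ : 1 / (d : ℝ) ≤ τ)
    (hgrowth : ∃ C > (0 : ℝ), ∀ N : ℕ, 1 ≤ N →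
      (1 / (N : ℝ)) * ∑ n ∈ Finset.Icc 1 N,
          matOpNorm d ((A n).map (Int.cast : ℤ → ℝ)) ≤ C * (N : ℝ) ^ τ)
    (hinv : ∀ n m : ℕ, n ≠ m → (A n - A m).det ≠ 0) :
    dimH {x : Fin d → ℝ | (∀ i, x i ∈ Set.Icc (0 : ℝ) 1) ∧
        ∃ h : Fin d → ℤ, h ≠ 0 ∧
          ¬ Filter.Tendsto
              (fun N : ℕ => (1 / (N : ℂ)) * ∑ n ∈ Finset.Icc 1 N,
                eC (∑ i : Fin d,
                  (Matrix.vecMul x ((A n).map (Int.cast : ℤ → ℝ))) i * (h i : ℝ)))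
              Filter.atTop (nhds 0)} ≤
      ENNReal.ofReal ((d : ℝ) - 1 / τ) := by
  have hd0 : (0 : ℝ) < d := by exact_mod_cast hd
  have hτ0 : 0 < τ := lt_of_lt_of_le (by positivity) hτ
  obtain ⟨C, hC, hgrowth⟩ := hgrowth
  refine ENNReal.le_of_forall_pos_le_add fun η hη _ => ?_
  set s : NNReal := Real.toNNReal ((d : ℝ) - 1 / τ) + η
  have hs : 0 < s := by positivity
  have hsd : (d : ℝ) - 1 / τ < s := by
    have h1 := Real.le_coe_toNNReal ((d : ℝ) - 1 / τ)
    have h2 : (0 : ℝ) < η := hη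
    push_cast [s]
    linarith
  have hgrow : ∀ h : Fin d → ℤ, ∃ L > (0 : ℝ), ∀ N : ℕ, 1 ≤ N →
      ∑ n ∈ Finset.Icc 1 N, ∑ i, |(((A n).mulVec h) i : ℝ)| ≤ L * (N : ℝ) ^ τ * N := by
    intro h
    set K : ℝ := d * ‖WithLp.toLp 2 (fun i => (h i : ℝ))‖
    have hK : 0 ≤ K := by positivity
    refine ⟨(K + 1) * C, by positivity, fun N hN => ?_⟩
    have hN0 : (0 : ℝ) < N := by exact_mod_cast hN
    have h1 := hgrowth N hN
    rw [one_div, inv_mul_le_iff₀ hN0] at h1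
    calc ∑ n ∈ Finset.Icc 1 N, ∑ i, |(((A n).mulVec h) i : ℝ)|
        ≤ K * ∑ n ∈ Finset.Icc 1 N, matOpNorm d ((A n).map (Int.cast : ℤ → ℝ)) := by
          rw [Finset.mul_sum]
          exact Finset.sum_le_sum fun n _ => sum_abs_mulVec_le (A n) h
      _ ≤ K * (N * (C * (N : ℝ) ^ τ)) := mul_le_mul_of_nonneg_left h1 hK
      _ ≤ (K + 1) * (N * (C * (N : ℝ) ^ τ)) := by gcongr; linarith
      _ = (K + 1) * C * (N : ℝ) ^ τ * N := by ring
  have hcover : {x : Fin d → ℝ | (∀ i, x i ∈ Set.Icc (0 : ℝ) 1) ∧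
        ∃ h : Fin d → ℤ, h ≠ 0 ∧
          ¬ Filter.Tendsto
              (fun N : ℕ => (1 / (N : ℂ)) * ∑ n ∈ Finset.Icc 1 N,
                eC (∑ i : Fin d,
                  (Matrix.vecMul x ((A n).map (Int.cast : ℤ → ℝ))) i * (h i : ℝ)))
              Filter.atTop (nhds 0)} ⊆
      ⋃ p : {h : Fin d → ℤ // h ≠ 0} × ℕ × ℕ,
        {x | (∀ i, x i ∈ Set.Icc (0 : ℝ) 1) ∧ ∃ᶠ k : ℕ in Filter.atTop,
          1 / ((p.2.2 : ℝ) + 1) * ⌊(1 + 1 / ((p.2.1 : ℝ) + 1)) ^ k⌋₊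
            ≤ ‖expSum (fun n => (A n).mulVec p.1.1) ⌊(1 + 1 / ((p.2.1 : ℝ) + 1)) ^ k⌋₊ x‖} := by
    rintro x ⟨hx, h, hh, hnot⟩
    simp_rw [sum_vecMul_map_mul] at hnot
    obtain ⟨l, m, hlm⟩ := exists_frequently_le_norm_expSum (fun n => (A n).mulVec h) x hnot
    exact Set.mem_iUnion.2 ⟨(⟨h, hh⟩, l, m), hx, hlm⟩
  refine (dimH_mono hcover).trans ?_
  rw [dimH_iUnion]
  refine iSup_le fun p => ?_
  obtain ⟨L, hL, hLgrow⟩ := hgrow p.1.1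
  have hc : 1 < 1 + 1 / ((p.2.1 : ℝ) + 1) := by
    have : 0 < 1 / ((p.2.1 : ℝ) + 1) := by positivity
    linarith
  have := dimH_frequently_le_norm_expSum _ (injective_mulVec hinv p.1.2) hτ0 hL hc
    (ε := 1 / ((p.2.2 : ℝ) + 1)) (by positivity) hLgrow hs hsd
  refine this.trans_eq ?_
  push_cast [s]
  rfl
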